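/- Let n be a positive integer, σ > 0, and let S be a real symmetric positive semidefinite n×n matrix. Define f : S_n → (−∞,+∞] by f(C) = log det(C⁻¹ + σ²I) if C is positive definite and +∞ otherwise; define T_S : S_n → (−∞,+∞] by T_S(C) = tr((I + σ²C)⁻¹ C S) if C is positive semidefinite and +∞ otherwise. Let g₀ be the spectral function on S_n associated with some ψ ∈ Γ0(ℝⁿ) invariant under permutations of coordinates, and let g₁ ∈ Γ0(S_n). If dom f ∩ dom g₀ ∩ dom g₁ ≠ ∅ and the function f + g₀ + g₁ is coercive on S_n, then the function F = f + T_S + g₀ + g₁ attains its infimum on S_n, i.e., F has a minimizer. -/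

import Mathlib

open Matrix Filter Topology Set

noncomputable section

/-- A real matrix is orthogonal. -/
def IsOrth {n : ℕ} (U : Matrix (Fin n) (Fin n) ℝ) : Prop := Uᵀ * U = 1

/-- `d` is a vector of eigenvalues of `C`, i.e. `C = U Diag(d) Uᵀ` for some orthogonal `U`. -/
def IsEigVec {n : ℕ} (C : Matrix (Fin n) (Fin n) ℝ) (d : Fin n → ℝ) : Prop :=
  ∃ U : Matrix (Fin n) (Fin n) ℝ, IsOrth U ∧ C = U * Matrix.diagonal d * Uᵀ

/-- Invariance under permutations of coordinates. -/
def PermInv {n : ℕ} (φ : (Fin n → ℝ) → EReal) : Prop :=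
  ∀ (σ : Equiv.Perm (Fin n)) (d : Fin n → ℝ), φ (d ∘ σ) = φ d

/-- `F` is the spectral function on symmetric matrices associated with `φ`. -/
def IsSpectral {n : ℕ} (F : Matrix (Fin n) (Fin n) ℝ → EReal)
    (φ : (Fin n → ℝ) → EReal) : Prop :=
  PermInv φ ∧ ∀ (C : Matrix (Fin n) (Fin n) ℝ) (d : Fin n → ℝ), IsEigVec C d → F C = φ d

/-- A function with values in (−∞,+∞] (represented in `EReal`, so it never takes the value ⊥)
which is finite somewhere. -/
def IsProper {α : Type*} (φ : α → EReal) : Prop := (∃ x, φ x ≠ ⊤) ∧ ∀ x, φ x ≠ ⊥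

/-- Convexity for extended-real-valued functions. -/
def EConvex {E : Type*} [AddCommGroup E] [Module ℝ E] (φ : E → EReal) : Prop :=
  ∀ (x y : E) (a b : ℝ), 0 ≤ a → 0 ≤ b → a + b = 1 →
    φ (a • x + b • y) ≤ (a : EReal) * φ x + (b : EReal) * φ y

/-- The class Γ₀ : proper, lower semicontinuous, convex functions into (−∞,+∞]. -/
def Gamma0 {E : Type*} [AddCommGroup E] [Module ℝ E] [TopologicalSpace E]
    (φ : E → EReal) : Prop :=
  IsProper φ ∧ LowerSemicontinuous φ ∧ EConvex φ

/-- Squared Frobenius norm. -/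
def frobSq {n : ℕ} (A : Matrix (Fin n) (Fin n) ℝ) : ℝ := ∑ i, ∑ j, (A i j) ^ 2

/-- Frobenius norm. -/
def frobNorm {n : ℕ} (A : Matrix (Fin n) (Fin n) ℝ) : ℝ := Real.sqrt (frobSq A)


open scoped Classical

/-- `f(C) = log det(C⁻¹ + σ²I)` for `C` positive definite, `+∞` otherwise. -/
def logdetF {n : ℕ} (σ : ℝ) (C : Matrix (Fin n) (Fin n) ℝ) : EReal :=
  if C.PosDef then
    ((Real.log (C⁻¹ + σ ^ 2 • (1 : Matrix (Fin n) (Fin n) ℝ)).det : ℝ) : EReal)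
  else ⊤

/-- `T_S(C) = tr((I + σ²C)⁻¹ C S)` for `C` positive semidefinite, `+∞` otherwise. -/
def traceTS {n : ℕ} (σ : ℝ) (S C : Matrix (Fin n) (Fin n) ℝ) : EReal :=
  if C.PosSemidef then ((((1 + σ ^ 2 • C)⁻¹ * C * S).trace : ℝ) : EReal) else ⊤

/-- `∇T_S(C) = (I + σ²C)⁻¹ S (I + σ²C)⁻¹`. -/
def gradTS {n : ℕ} (σ : ℝ) (S C : Matrix (Fin n) (Fin n) ℝ) :
    Matrix (Fin n) (Fin n) ℝ :=
  (1 + σ ^ 2 • C)⁻¹ * S * (1 + σ ^ 2 • C)⁻¹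

theorem aux_spec {n : ℕ} {C : Matrix (Fin n) (Fin n) ℝ} (hC : C.IsSymm) :
    ∃ (U : Matrix (Fin n) (Fin n) ℝ) (d : Fin n → ℝ), IsOrth U ∧ C = U * Matrix.diagonal d * Uᵀ := by
  have hH : C.IsHermitian := by
    rw [Matrix.IsHermitian, Matrix.conjTranspose_eq_transpose_of_trivial]; exact hC
  refine ⟨hH.eigenvectorUnitary, hH.eigenvalues, ?_, ?_⟩
  · have := (Matrix.mem_unitaryGroup_iff').1 hH.eigenvectorUnitary.2
    rw [Matrix.star_eq_conjTranspose, Matrix.conjTranspose_eq_transpose_of_trivial] at this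
    exact this
  · have := hH.spectral_theorem
    rw [Unitary.conjStarAlgAut_apply, Matrix.star_eq_conjTranspose,
      Matrix.conjTranspose_eq_transpose_of_trivial] at this
    exact this

theorem aux_diag {n : ℕ} {U : Matrix (Fin n) (Fin n) ℝ} {d : Fin n → ℝ} (hU : IsOrth U) :
    Matrix.diag (Uᵀ * (U * Matrix.diagonal d * Uᵀ) * U) = d := by
  have : Uᵀ * (U * Matrix.diagonal d * Uᵀ) * U = (Uᵀ * U) * Matrix.diagonal d * (Uᵀ * U) := by
    simp only [Matrix.mul_assoc]
  rw [this, hU, Matrix.one_mul, Matrix.mul_one, Matrix.diag_diagonal]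

theorem aux_symm {n : ℕ} {C : Matrix (Fin n) (Fin n) ℝ} (hC : C.PosSemidef) : C.IsSymm := by
  have := hC.1
  rwa [Matrix.IsHermitian, Matrix.conjTranspose_eq_transpose_of_trivial] at this

theorem aux_A {n : ℕ} (σ : ℝ) {C : Matrix (Fin n) (Fin n) ℝ} (hC : C.PosSemidef) :
    (1 + σ ^ 2 • C).PosDef :=
  Matrix.PosDef.one.add_posSemidef (hC.smul (sq_nonneg σ))

theorem aux_trace {n : ℕ} {M S : Matrix (Fin n) (Fin n) ℝ} (hM : M.PosSemidef)
    (hS : S.PosSemidef) : 0 ≤ (M * S).trace := by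
  obtain ⟨U, d, hU, hSe⟩ := aux_spec (aux_symm hS)
  have hd : ∀ i, 0 ≤ d i := by
    intro i
    have h := (hS.conjTranspose_mul_mul_same U).diag_nonneg (i := i)
    rw [Matrix.conjTranspose_eq_transpose_of_trivial] at h
    have h2 := congrFun (aux_diag (d := d) hU) i
    rw [← hSe] at h2
    rw [← h2]; exact h
  have hM2 := hM.conjTranspose_mul_mul_same U
  rw [Matrix.conjTranspose_eq_transpose_of_trivial] at hM2
  have : (M * S).trace = (Uᵀ * M * U * Matrix.diagonal d).trace := by
    have e : Uᵀ * M * U * Matrix.diagonal d = Uᵀ * (M * U * Matrix.diagonal d) := by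
      simp only [Matrix.mul_assoc]
    rw [hSe, e, Matrix.trace_mul_comm Uᵀ]
    simp only [Matrix.mul_assoc]
  rw [this, Matrix.trace]
  apply Finset.sum_nonneg
  intro i _
  rw [Matrix.diag_apply, Matrix.mul_diagonal]
  exact mul_nonneg hM2.diag_nonneg (hd i)

theorem aux_T {n : ℕ} (σ : ℝ) {C S : Matrix (Fin n) (Fin n) ℝ} (hC : C.PosSemidef)
    (hS : S.PosSemidef) : 0 ≤ ((1 + σ ^ 2 • C)⁻¹ * C * S).trace := by
  apply aux_trace _ hS
  have hA := aux_A σ hC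
  have hAi := hA.inv
  have hu : IsUnit (1 + σ ^ 2 • C).det := (Matrix.isUnit_iff_isUnit_det _).1 hA.isUnit
  have hC2 : (C * (1 + σ ^ 2 • C)).PosSemidef := by
    rw [Matrix.mul_add, Matrix.mul_one, Matrix.mul_smul]
    refine hC.add (Matrix.PosSemidef.smul ?_ (sq_nonneg σ))
    have := hC.pow 2
    rwa [pow_two] at this
  have h := hC2.mul_mul_conjTranspose_same (1 + σ ^ 2 • C)⁻¹
  rw [hAi.1.eq, Matrix.mul_assoc, Matrix.mul_assoc, Matrix.mul_nonsing_inv _ hu,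
    Matrix.mul_one] at h
  exact h

theorem aux_f {n : ℕ} (σ : ℝ) {C : Matrix (Fin n) (Fin n) ℝ} (hC : C.PosSemidef) :
    logdetF σ C = ENNReal.log (ENNReal.ofReal (1 + σ ^ 2 • C).det / ENNReal.ofReal C.det) := by
  have hA := (aux_A σ hC).det_pos
  unfold logdetF
  split_ifs with h
  · have hd := h.det_pos
    have hu : IsUnit C.det := hd.ne'.isUnit
    rw [← ENNReal.ofReal_div_of_pos hd, ENNReal.log_ofReal_of_pos (div_pos hA hd)]
    congr 2
    rw [eq_div_iff hd.ne', ← Matrix.det_mul, Matrix.add_mul, Matrix.nonsing_inv_mul _ hu,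
      Matrix.smul_mul, Matrix.one_mul]
  · have hd : C.det = 0 := by
      by_contra h0
      exact h (hC.posDef_iff_det_ne_zero.2 h0)
    rw [hd, ENNReal.ofReal_zero, ENNReal.div_zero, ENNReal.log_top]
    simpa using hA

theorem aux_f_cont {n : ℕ} (σ : ℝ) :
    ContinuousOn (fun C : Matrix (Fin n) (Fin n) ℝ => logdetF σ C) {C | C.PosSemidef} := by
  refine ContinuousOn.congr (f := fun C => ENNReal.log (ENNReal.ofReal (1 + σ ^ 2 • C).det / ENNReal.ofReal C.det)) ?_ (fun C hC => aux_f σ hC)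
  refine ENNReal.continuous_log.comp_continuousOn ?_
  intro C hC
  have hA := (aux_A σ hC).det_pos
  apply ContinuousAt.continuousWithinAt
  have h1 : Continuous fun C : Matrix (Fin n) (Fin n) ℝ => ENNReal.ofReal (1 + σ ^ 2 • C).det :=
    ENNReal.continuous_ofReal.comp (by fun_prop)
  have h2 : Continuous fun C : Matrix (Fin n) (Fin n) ℝ => ENNReal.ofReal C.det :=
    ENNReal.continuous_ofReal.comp (by fun_prop)
  exact ENNReal.Tendsto.div h1.continuousAt (Or.inl (by simpa using hA)) h2.continuousAt
    (Or.inr ENNReal.ofReal_ne_top)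

theorem aux_T_cont {n : ℕ} (σ : ℝ) (S : Matrix (Fin n) (Fin n) ℝ) :
    ContinuousOn (fun C : Matrix (Fin n) (Fin n) ℝ => traceTS σ S C) {C | C.PosSemidef} := by
  refine ContinuousOn.congr (f := fun C => ((((1 + σ ^ 2 • C)⁻¹ * C * S).trace : ℝ) : EReal)) ?_
    (fun C hC => by
      have hC' : C.PosSemidef := hC
      simp only [traceTS, if_pos hC'])
  refine continuous_coe_real_ereal.comp_continuousOn ?_
  intro C hC
  have hA := (aux_A σ hC).det_pos
  apply ContinuousAt.continuousWithinAt
  have h0 : ContinuousAt (fun C : Matrix (Fin n) (Fin n) ℝ => (1 + σ ^ 2 • C)⁻¹) C := by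
    simp only [Matrix.inv_def, Ring.inverse_eq_inv']
    have a1 : ContinuousAt (fun C : Matrix (Fin n) (Fin n) ℝ => (1 + σ ^ 2 • C).det) C :=
      Continuous.continuousAt (by fun_prop)
    have a2 : ContinuousAt (fun C : Matrix (Fin n) (Fin n) ℝ => (1 + σ ^ 2 • C).adjugate) C :=
      Continuous.continuousAt (by fun_prop)
    exact (a1.inv₀ hA.ne').smul a2
  have hid : ContinuousAt (fun C : Matrix (Fin n) (Fin n) ℝ => C) C := continuousAt_id
  have h1 := (h0.mul hid).mul (continuousAt_const (y := S))
  exact (Continuous.matrix_trace continuous_id).continuousAt.comp h1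

theorem aux_psd_closed {n : ℕ} : IsClosed {C : Matrix (Fin n) (Fin n) ℝ | C.PosSemidef} := by
  simp only [Matrix.posSemidef_iff_dotProduct_mulVec, Matrix.IsHermitian, Set.setOf_and,
    Set.setOf_forall]
  refine IsClosed.inter (isClosed_eq (by fun_prop) (by fun_prop)) (isClosed_iInter fun x => ?_)
  exact isClosed_le continuous_const (by fun_prop)

theorem aux_cpt {n : ℕ} (r : ℝ) :
    IsCompact {C : Matrix (Fin n) (Fin n) ℝ | frobSq C ≤ r ^ 2} := by
  have hbox : IsCompact (Set.univ.pi fun _ : Fin n => Set.univ.pi fun _ : Fin n =>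
      Set.Icc (-|r|) |r|) :=
    isCompact_univ_pi fun _ => isCompact_univ_pi fun _ => isCompact_Icc
  refine IsCompact.of_isClosed_subset (X := Matrix (Fin n) (Fin n) ℝ) hbox ?_ ?_
  · refine isClosed_le ?_ continuous_const
    unfold frobSq
    fun_prop
  · intro C hC i _ j _
    have h : (C i j) ^ 2 ≤ r ^ 2 := by
      refine le_trans ?_ hC
      refine le_trans ?_ (Finset.single_le_sum (f := fun i => ∑ j, (C i j) ^ 2)
        (fun i _ => Finset.sum_nonneg fun j _ => sq_nonneg _) (Finset.mem_univ i))
      exact Finset.single_le_sum (f := fun j => (C i j) ^ 2) (fun j _ => sq_nonneg _)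
        (Finset.mem_univ j)
    exact abs_le.1 (sq_le_sq.1 h)

theorem aux_orth {n : ℕ} : IsCompact {U : Matrix (Fin n) (Fin n) ℝ | IsOrth U} := by
  refine (aux_cpt (n := n) (Real.sqrt n)).of_isClosed_subset ?_ ?_
  · unfold IsOrth
    exact isClosed_eq (by fun_prop) continuous_const
  · intro U hU
    have h : frobSq U = (Uᵀ * U).trace := by
      simp only [frobSq, Matrix.trace, Matrix.diag_apply, Matrix.mul_apply, Matrix.transpose_apply]
      rw [Finset.sum_comm]
      simp only [pow_two]
    have hU' : Uᵀ * U = 1 := hU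
    rw [hU'] at h
    simp only [Set.mem_setOf_eq, h]
    rw [Real.sq_sqrt (Nat.cast_nonneg n)]
    simp

theorem aux_add {α : Type*} [TopologicalSpace α] {s : Set α} {f g : α → EReal}
    (hf : LowerSemicontinuousOn f s) (hg : LowerSemicontinuousOn g s)
    (hfb : ∀ x ∈ s, f x ≠ ⊥) (hgb : ∀ x ∈ s, g x ≠ ⊥) :
    LowerSemicontinuousOn (fun x => f x + g x) s :=
  hf.add' hg fun x hx => EReal.continuousAt_add (Or.inr (hgb x hx)) (Or.inl (hfb x hx))

theorem aux_f_bot {n : ℕ} (σ : ℝ) (C : Matrix (Fin n) (Fin n) ℝ) : logdetF σ C ≠ ⊥ := by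
  unfold logdetF; split_ifs <;> simp

theorem aux_T_bot {n : ℕ} (σ : ℝ) (S C : Matrix (Fin n) (Fin n) ℝ) : traceTS σ S C ≠ ⊥ := by
  unfold traceTS; split_ifs <;> simp

theorem aux_nb {a b : EReal} (ha : a ≠ ⊥) (hb : b ≠ ⊥) : a + b ≠ ⊥ := by
  simp [EReal.add_eq_bot_iff, ha, hb]

/-- If `dom f ∩ dom g₀ ∩ dom g₁ ≠ ∅` and `f + g₀ + g₁` is coercive on the space
of symmetric matrices, then `F = f + T_S + g₀ + g₁` attains its infimum over symmetric
matrices. -/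
theorem stmt15 (n : ℕ) (hn : 0 < n) (σ : ℝ) (hσ : 0 < σ)
    (S : Matrix (Fin n) (Fin n) ℝ) (hS : S.PosSemidef)
    (g₀ g₁ : Matrix (Fin n) (Fin n) ℝ → EReal) (ψ : (Fin n → ℝ) → EReal)
    (hψ : Gamma0 ψ) (hg₀ : IsSpectral g₀ ψ) (hg₁ : Gamma0 g₁)
    (hdom : ∃ C : Matrix (Fin n) (Fin n) ℝ, logdetF σ C ≠ ⊤ ∧ g₀ C ≠ ⊤ ∧ g₁ C ≠ ⊤)
    (hcoer : ∀ M : ℝ, ∃ R : ℝ, ∀ C : Matrix (Fin n) (Fin n) ℝ, C.IsSymm →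
      R ≤ frobNorm C → (M : EReal) ≤ logdetF σ C + g₀ C + g₁ C) :
    ∃ Chat : Matrix (Fin n) (Fin n) ℝ, Chat.IsSymm ∧
      ∀ C : Matrix (Fin n) (Fin n) ℝ, C.IsSymm →
        logdetF σ Chat + traceTS σ S Chat + g₀ Chat + g₁ Chat
          ≤ logdetF σ C + traceTS σ S C + g₀ C + g₁ C := by
  have hψb := hψ.1.2
  have hg₁b := hg₁.1.2
  obtain ⟨C₀, hf0, hg00, hg10⟩ := hdom
  have hpd0 : C₀.PosDef := by
    by_contra h
    exact hf0 (if_neg h)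
  have hps0 := hpd0.posSemidef
  have hg₀b : ∀ C : Matrix (Fin n) (Fin n) ℝ, C.IsSymm → g₀ C ≠ ⊥ := by
    intro C hC
    obtain ⟨U, d, hU, h⟩ := aux_spec hC
    rw [hg₀.2 C d ⟨U, hU, h⟩]
    exact hψb d
  have hg00b := hg₀b C₀ (aux_symm hps0)
  -- real upper bound for the value at C₀
  obtain ⟨M, hM⟩ : ∃ M : ℝ, logdetF σ C₀ + traceTS σ S C₀ + g₀ C₀ + g₁ C₀ ≤ (M : EReal) := by
    have ht : traceTS σ S C₀ ≠ ⊤ := by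
      unfold traceTS; rw [if_pos hps0]; simp
    refine ⟨(logdetF σ C₀).toReal + (traceTS σ S C₀).toReal + (g₀ C₀).toReal + (g₁ C₀).toReal, ?_⟩
    push_cast
    rw [EReal.coe_toReal hf0 (aux_f_bot _ _), EReal.coe_toReal ht (aux_T_bot _ _ _),
      EReal.coe_toReal hg00 hg00b, EReal.coe_toReal hg10 (hg₁b _)]
  obtain ⟨R, hR⟩ := hcoer M
  set r := max R (frobNorm C₀) with hr
  have hr0 : 0 ≤ r := le_trans (Real.sqrt_nonneg _) (le_max_right _ _)
  let D : Matrix (Fin n) (Fin n) ℝ × Matrix (Fin n) (Fin n) ℝ → (Fin n → ℝ) :=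
    fun p => Matrix.diag (p.1ᵀ * p.2 * p.1)
  have hD : Continuous D := by fun_prop
  let K : Set (Matrix (Fin n) (Fin n) ℝ × Matrix (Fin n) (Fin n) ℝ) :=
    ({U | IsOrth U} ×ˢ {C | frobSq C ≤ r ^ 2}) ∩
      ({p | p.2.PosSemidef} ∩ {p | p.2 = p.1 * Matrix.diagonal (D p) * p.1ᵀ})
  have hK : IsCompact K := by
    refine (aux_orth.prod (aux_cpt r)).inter_right (IsClosed.inter ?_ ?_)
    · exact aux_psd_closed.preimage continuous_snd
    · exact isClosed_eq (by fun_prop) (by fun_prop)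
  have hmem : ∀ C : Matrix (Fin n) (Fin n) ℝ, C.PosSemidef → frobNorm C ≤ r →
      ∃ U, (U, C) ∈ K := by
    intro C hC hCr
    obtain ⟨U, d, hU, h⟩ := aux_spec (aux_symm hC)
    refine ⟨U, ⟨hU, ?_⟩, hC, ?_⟩
    · exact (Real.sqrt_le_left hr0).1 hCr
    · have hd : D (U, C) = d := by
        simp only [D]
        rw [h]
        exact aux_diag hU
      simp only [Set.mem_setOf_eq, hd]
      exact h
  have hval : ∀ p ∈ K, g₀ p.2 = ψ (D p) := fun p hp =>
    hg₀.2 p.2 (D p) ⟨p.1, hp.1.1, hp.2.2⟩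
  obtain ⟨U₀, hU₀⟩ := hmem C₀ hps0 (le_max_right _ _)
  have hmaps : Set.MapsTo (Prod.snd : Matrix (Fin n) (Fin n) ℝ × Matrix (Fin n) (Fin n) ℝ → _) K
      {C | C.PosSemidef} := fun p hp => hp.2.1
  have hlsc : LowerSemicontinuousOn
      (fun p => logdetF σ p.2 + traceTS σ S p.2 + ψ (D p) + g₁ p.2) K := by
    have l1 : LowerSemicontinuousOn (fun p : Matrix (Fin n) (Fin n) ℝ × Matrix (Fin n) (Fin n) ℝ =>
        logdetF σ p.2) K :=
      ((aux_f_cont σ).comp continuous_snd.continuousOn hmaps).lowerSemicontinuousOn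
    have l2 : LowerSemicontinuousOn (fun p : Matrix (Fin n) (Fin n) ℝ × Matrix (Fin n) (Fin n) ℝ =>
        traceTS σ S p.2) K :=
      ((aux_T_cont σ S).comp continuous_snd.continuousOn hmaps).lowerSemicontinuousOn
    have l3 : LowerSemicontinuousOn (fun p => ψ (D p)) K :=
      (hψ.2.1.comp hD).lowerSemicontinuousOn K
    have l4 : LowerSemicontinuousOn (fun p : Matrix (Fin n) (Fin n) ℝ × Matrix (Fin n) (Fin n) ℝ =>
        g₁ p.2) K :=
      (hg₁.2.1.comp continuous_snd).lowerSemicontinuousOn K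
    refine aux_add (aux_add (aux_add l1 l2 ?_ ?_) l3 ?_ ?_) l4 ?_ ?_
    · exact fun p _ => aux_f_bot _ _
    · exact fun p _ => aux_T_bot _ _ _
    · exact fun p _ => aux_nb (aux_f_bot _ _) (aux_T_bot _ _ _)
    · exact fun p _ => hψb _
    · exact fun p _ => aux_nb (aux_nb (aux_f_bot _ _) (aux_T_bot _ _ _)) (hψb _)
    · exact fun p _ => hg₁b _
  obtain ⟨p, hp, hmin⟩ := hlsc.exists_isMinOn ⟨_, hU₀⟩ hK
  have hmin' : ∀ C : Matrix (Fin n) (Fin n) ℝ, C.PosSemidef → frobNorm C ≤ r →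
      logdetF σ p.2 + traceTS σ S p.2 + g₀ p.2 + g₁ p.2
          ≤ logdetF σ C + traceTS σ S C + g₀ C + g₁ C := by
    intro C hC hCr
    obtain ⟨U, hU⟩ := hmem C hC hCr
    have h := isMinOn_iff.1 hmin _ hU
    rw [hval p hp, hval _ hU]
    exact h
  refine ⟨p.2, aux_symm hp.2.1, fun C hC => ?_⟩
  by_cases hps : C.PosSemidef
  · by_cases hCr : frobNorm C ≤ r
    · exact hmin' C hps hCr
    · have h1 := hR C hC (le_trans (le_max_left _ _) (not_le.1 hCr).le)
      refine (hmin' C₀ hps0 (le_max_right _ _)).trans (hM.trans (h1.trans ?_))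
      have ht : 0 ≤ traceTS σ S C := by
        unfold traceTS; rw [if_pos hps]
        exact_mod_cast aux_T σ hps hS
      gcongr
      exact le_add_of_nonneg_right ht
  · have hf : logdetF σ C = ⊤ := if_neg fun h => hps h.posSemidef
    have : logdetF σ C + traceTS σ S C + g₀ C + g₁ C = ⊤ := by
      rw [hf, EReal.top_add_of_ne_bot (aux_T_bot _ _ _), EReal.top_add_of_ne_bot (hg₀b C hC),
        EReal.top_add_of_ne_bot (hg₁b C)]
    rw [this]
    exact le_top
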